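/- Let n ≥ 1 and 1 < p ≤ 1 + 2/n. Let u : ℝⁿ × (0,∞) → ℝ be a classical solution (C² in the space variable and C¹ in the time variable on ℝⁿ × (0,∞), continuous up to t = 0) of u_t = Δu + |u|^p on ℝⁿ × (0,∞), bounded from below and with u(·,0) = u₀ ≥ 0. Then u ≡ 0 on ℝⁿ × [0,∞). -/

import Mathlib

open MeasureTheory Real Set

/-- The Laplacian in the space variables on Euclidean space: the sum of the pure second
directional derivatives along the standard coordinate directions. -/
noncomputable def laplacian {n : ℕ} (f : EuclideanSpace ℝ (Fin n) → ℝ)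
    (x : EuclideanSpace ℝ (Fin n)) : ℝ :=
  ∑ i, fderiv ℝ (fun y => fderiv ℝ f y (EuclideanSpace.single i 1)) x (EuclideanSpace.single i 1)

open Filter Topology

theorem fj_second_deriv_test (g : ℝ → ℝ) (hg : Continuous g) (h : IsLocalMin g 0) :
    0 ≤ deriv (deriv g) 0 := by
  by_contra hneg
  push Not at hneg
  have h1 : deriv g 0 = 0 := h.deriv_eq_zero
  have h2 : IsLocalMax g 0 := isLocalMax_of_deriv_deriv_neg hneg h1 hg.continuousAt
  have h3 : g =ᶠ[𝓝 0] fun _ => g 0 := by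
    filter_upwards [h, h2] with y hy hy'
    exact le_antisymm hy' hy
  have h4 : deriv (deriv g) 0 = 0 := by
    have := h3.deriv.deriv_eq
    simpa using this
  linarith

theorem fj_diff_fderiv {n : ℕ} {f : EuclideanSpace ℝ (Fin n) → ℝ} (hf : ContDiff ℝ 2 f)
    (v : EuclideanSpace ℝ (Fin n)) : Differentiable ℝ (fun y => fderiv ℝ f y v) := by
  have h : ContDiff ℝ 1 (fderiv ℝ f) := hf.fderiv_right (by norm_num)
  exact (h.differentiable (by norm_num)).clm_apply (differentiable_const v)

theorem fj_lap_nonneg {n : ℕ} {f : EuclideanSpace ℝ (Fin n) → ℝ} (hf : ContDiff ℝ 2 f)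
    {x : EuclideanSpace ℝ (Fin n)} (h : IsLocalMin f x) : 0 ≤ laplacian f x := by
  unfold laplacian
  refine Finset.sum_nonneg fun i _ => ?_
  set v : EuclideanSpace ℝ (Fin n) := EuclideanSpace.single i 1 with hv
  have hline : ∀ s : ℝ, HasDerivAt (fun s : ℝ => x + s • v) v s := by
    intro s
    simpa using ((hasDerivAt_id s).smul_const v).const_add x
  have hd1 : deriv (fun s : ℝ => f (x + s • v)) = fun s => fderiv ℝ f (x + s • v) v := by
    funext s
    have := ((hf.differentiable (by norm_num)) (x + s • v)).hasFDerivAt.comp_hasDerivAt s (hline s)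
    exact this.deriv
  have hd2 : deriv (deriv (fun s : ℝ => f (x + s • v))) 0
      = fderiv ℝ (fun y => fderiv ℝ f y v) x v := by
    rw [hd1]
    have h0 := (fj_diff_fderiv hf v (x + (0 : ℝ) • v)).hasFDerivAt.comp_hasDerivAt 0 (hline 0)
    have := h0.deriv
    simpa [Function.comp_def] using this
  rw [← hd2]
  apply fj_second_deriv_test
  · have := hf.continuous
    fun_prop
  · have hc : ContinuousAt (fun s : ℝ => x + s • v) 0 := (hline 0).continuousAt
    have ht : Tendsto (fun s : ℝ => x + s • v) (𝓝 0) (𝓝 x) := by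
      simpa [ContinuousAt] using hc
    have := ht.eventually h
    simpa [IsLocalMin, IsMinFilter] using this

theorem fj_lap_sub {n : ℕ} {f g : EuclideanSpace ℝ (Fin n) → ℝ} (hf : ContDiff ℝ 2 f)
    (hg : ContDiff ℝ 2 g) (x : EuclideanSpace ℝ (Fin n)) :
    laplacian (fun y => f y - g y) x = laplacian f x - laplacian g x := by
  unfold laplacian
  rw [← Finset.sum_sub_distrib]
  refine Finset.sum_congr rfl fun i _ => ?_
  have h1 : (fun y => fderiv ℝ (fun y => f y - g y) y (EuclideanSpace.single i 1)) =
      fun y => fderiv ℝ f y (EuclideanSpace.single i 1) - fderiv ℝ g y (EuclideanSpace.single i 1) := by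
    funext y
    rw [fderiv_fun_sub (hf.differentiable (by norm_num) y) (hg.differentiable (by norm_num) y)]
    rfl
  rw [h1, fderiv_fun_sub (fj_diff_fderiv hf _ x) (fj_diff_fderiv hg _ x)]
  rfl

theorem fj_lap_add_const {n : ℕ} (f : EuclideanSpace ℝ (Fin n) → ℝ) (c : ℝ)
    (x : EuclideanSpace ℝ (Fin n)) :
    laplacian (fun y => f y + c) x = laplacian f x := by
  unfold laplacian
  simp [fderiv_add_const]

theorem fj_coord {n : ℕ} (i : Fin n) (x0 y : EuclideanSpace ℝ (Fin n)) :
    HasFDerivAt (fun y : EuclideanSpace ℝ (Fin n) => y i - x0 i)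
      (EuclideanSpace.proj i : EuclideanSpace ℝ (Fin n) →L[ℝ] ℝ) y := by
  exact ((EuclideanSpace.proj i : EuclideanSpace ℝ (Fin n) →L[ℝ] ℝ).hasFDerivAt).sub_const _

theorem fj_normsq {n : ℕ} (x0 y : EuclideanSpace ℝ (Fin n)) :
    HasFDerivAt (fun y : EuclideanSpace ℝ (Fin n) => ‖y - x0‖ ^ 2)
      ((2 : ℝ) • innerSL ℝ (y - x0)) y := by
  have := ((hasFDerivAt_id y).sub_const x0).norm_sq
  refine HasFDerivAt.congr_fderiv (f := fun y : EuclideanSpace ℝ (Fin n) => ‖y - x0‖ ^ 2) this ?_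
  ext v
  simp [two_smul]

theorem fj_inner {n : ℕ} (i : Fin n) (y : EuclideanSpace ℝ (Fin n)) :
    inner ℝ y (EuclideanSpace.single i (1 : ℝ)) = y i := by
  simp [EuclideanSpace.inner_single_right]

theorem fj_lap_sq {n : ℕ} (ε : ℝ) (x0 x : EuclideanSpace ℝ (Fin n)) :
    laplacian (fun y => ε * ‖y - x0‖ ^ 2) x = 2 * n * ε := by
  unfold laplacian
  have h : ∀ i : Fin n, (fun y : EuclideanSpace ℝ (Fin n) =>
      fderiv ℝ (fun y => ε * ‖y - x0‖ ^ 2) y (EuclideanSpace.single i 1))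
      = fun y => (ε * 2) * (y i - x0 i) := by
    intro i
    funext y
    rw [((fj_normsq x0 y).const_mul ε).fderiv]
    simp [fj_inner]
    ring
  simp only [h]
  have h2 : ∀ i : Fin n, fderiv ℝ (fun y : EuclideanSpace ℝ (Fin n) => (ε * 2) * (y i - x0 i)) x
      (EuclideanSpace.single i 1) = ε * 2 := by
    intro i
    rw [((fj_coord i x0 x).const_mul (ε * 2)).fderiv]
    simp
  simp only [h2]
  simp
  ring

theorem fj_lap_gauss {n : ℕ} (a β : ℝ) (x0 x : EuclideanSpace ℝ (Fin n)) :
    laplacian (fun y => a * Real.exp (-(β * ‖y - x0‖ ^ 2))) x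
      = a * Real.exp (-(β * ‖x - x0‖ ^ 2)) * (4 * β ^ 2 * ‖x - x0‖ ^ 2 - 2 * n * β) := by
  unfold laplacian
  have h0 : ∀ y : EuclideanSpace ℝ (Fin n),
      HasFDerivAt (fun y => a * Real.exp (-(β * ‖y - x0‖ ^ 2)))
      (a • (Real.exp (-(β * ‖y - x0‖ ^ 2)) • (-(β • ((2 : ℝ) • innerSL ℝ (y - x0)))))) y := by
    intro y
    exact (((fj_normsq x0 y).const_mul β).fun_neg.exp).const_mul a
  have h : ∀ i : Fin n, (fun y : EuclideanSpace ℝ (Fin n) =>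
      fderiv ℝ (fun y => a * Real.exp (-(β * ‖y - x0‖ ^ 2))) y (EuclideanSpace.single i 1))
      = fun y => (a * Real.exp (-(β * ‖y - x0‖ ^ 2))) * ((-2 * β) * (y i - x0 i)) := by
    intro i
    funext y
    rw [(h0 y).fderiv]
    simp [fj_inner]
    ring
  simp only [h]
  have h2 : ∀ i : Fin n, fderiv ℝ (fun y : EuclideanSpace ℝ (Fin n) =>
      (a * Real.exp (-(β * ‖y - x0‖ ^ 2))) * ((-2 * β) * (y i - x0 i))) x
      (EuclideanSpace.single i 1) = a * Real.exp (-(β * ‖x - x0‖ ^ 2)) *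
        (4 * β ^ 2 * (x i - x0 i) ^ 2 - 2 * β) := by
    intro i
    rw [((h0 x).fun_mul ((fj_coord i x0 x).const_mul (-2 * β))).fderiv]
    simp [fj_inner]
    ring
  simp only [h2]
  rw [← Finset.mul_sum, Finset.sum_sub_distrib, ← Finset.mul_sum, EuclideanSpace.norm_sq_eq]
  simp
  ring_nf
  left; trivial

theorem fj_cd_gauss {n : ℕ} (a β : ℝ) (x0 : EuclideanSpace ℝ (Fin n)) :
    ContDiff ℝ 2 (fun y => a * Real.exp (-(β * ‖y - x0‖ ^ 2))) := by
  have : ContDiff ℝ 2 (fun y : EuclideanSpace ℝ (Fin n) => ‖y - x0‖ ^ 2) :=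
    (contDiff_id.sub contDiff_const).norm_sq ℝ
  fun_prop

theorem fj_cd_sq {n : ℕ} (ε : ℝ) (x0 : EuclideanSpace ℝ (Fin n)) :
    ContDiff ℝ 2 (fun y => ε * ‖y - x0‖ ^ 2) := by
  have : ContDiff ℝ 2 (fun y : EuclideanSpace ℝ (Fin n) => ‖y - x0‖ ^ 2) :=
    (contDiff_id.sub contDiff_const).norm_sq ℝ
  fun_prop

/-- minimum principle -/
theorem fj_min_principle {n : ℕ} (S : Set (EuclideanSpace ℝ (Fin n))) (hS : IsClosed S)
    (w : EuclideanSpace ℝ (Fin n) → ℝ → ℝ) (T0 T1 K : ℝ)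
    (hc : ContinuousOn (fun q : EuclideanSpace ℝ (Fin n) × ℝ => w q.1 q.2) (S ×ˢ Icc T0 T1))
    (h0 : ∀ x ∈ S, 0 ≤ w x T0)
    (hinf : ∀ ε > 0, ∃ R : ℝ, ∀ x ∈ S, R ≤ ‖x‖ → ∀ t ∈ Icc T0 T1, -ε ≤ w x t)
    (hw : ∀ x ∈ S, ∀ t ∈ Ioc T0 T1, w x t < 0 → x ∈ interior S ∧ DifferentiableAt ℝ (w x) t ∧
      ContDiff ℝ 2 (fun y => w y t) ∧
      laplacian (fun y => w y t) x + K * w x t ≤ deriv (w x) t) :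
    ∀ x ∈ S, ∀ t ∈ Icc T0 T1, 0 ≤ w x t := by
  intro x1 hx1 t1 ht1
  by_contra hneg
  push Not at hneg
  set L := K + 1 with hL
  set v : EuclideanSpace ℝ (Fin n) × ℝ → ℝ := fun q => Real.exp (-L * q.2) * w q.1 q.2 with hv
  have hvneg : v (x1, t1) < 0 := mul_neg_of_pos_of_neg (Real.exp_pos _) hneg
  -- bound on the exponential
  obtain ⟨M, hM⟩ : ∃ M, ∀ t ∈ Icc T0 T1, Real.exp (-L * t) ≤ M := by
    have : ContinuousOn (fun t => Real.exp (-L * t)) (Icc T0 T1) := by fun_prop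
    obtain ⟨M, hM⟩ := isCompact_Icc.bddAbove_image this
    exact ⟨M, fun t ht => hM (mem_image_of_mem _ ht)⟩
  have hMpos : 0 < M := lt_of_lt_of_le (Real.exp_pos _) (hM t1 ht1)
  obtain ⟨R, hR⟩ := hinf (-v (x1, t1) / (2 * M)) (by apply div_pos <;> linarith)
  set C : Set (EuclideanSpace ℝ (Fin n) × ℝ) :=
    (S ∩ Metric.closedBall 0 (max R ‖x1‖)) ×ˢ Icc T0 T1 with hC
  have hCc : IsCompact C :=
    ((isCompact_closedBall _ _).inter_left hS).prod isCompact_Icc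
  have hvC : ContinuousOn v C := by
    have : ContinuousOn (fun q : EuclideanSpace ℝ (Fin n) × ℝ => w q.1 q.2) C :=
      hc.mono (prod_mono inter_subset_left le_rfl)
    exact (Continuous.continuousOn (by fun_prop)).mul this
  have hmem : (x1, t1) ∈ C := ⟨⟨hx1, by simp⟩, ht1⟩
  obtain ⟨⟨x, t⟩, hxt, hmin⟩ := hCc.exists_isMinOn ⟨_, hmem⟩ hvC
  have hle1 : v (x, t) ≤ v (x1, t1) := hmin hmem
  have hxS : x ∈ S := hxt.1.1
  have htI : t ∈ Icc T0 T1 := hxt.2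
  have hmin' : ∀ y ∈ S, ∀ s ∈ Icc T0 T1, v (x, t) ≤ v (y, s) := by
    intro y hy s hs
    by_cases hyR : ‖y‖ ≤ max R ‖x1‖
    · exact hmin (show (y, s) ∈ C from ⟨⟨hy, by simpa using hyR⟩, hs⟩)
    · push Not at hyR
      have h1 := hR y hy ((le_max_left _ _).trans hyR.le) s hs
      have h2 := hM s hs
      have h3 := Real.exp_pos (-L * s)
      have h4 : v (x1, t1) ≤ v (y, s) := by
        set e := -v (x1, t1) / (2 * M) with he
        have he0 : 0 < e := by apply div_pos <;> linarith
        have h5 : M * e = - v (x1, t1) / 2 := by rw [he]; field_simp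
        have h6 : Real.exp (-L * s) * (-e) ≤ Real.exp (-L * s) * w y s :=
          mul_le_mul_of_nonneg_left h1 h3.le
        have h7 : Real.exp (-L * s) * e ≤ M * e := mul_le_mul_of_nonneg_right h2 he0.le
        show _ ≤ Real.exp (-L * s) * w y s
        linarith
      linarith
  have hwneg : w x t < 0 := by
    by_contra h
    push Not at h
    have : 0 ≤ v (x, t) := mul_nonneg (Real.exp_pos _).le h
    linarith
  have htT : T0 < t := by
    rcases eq_or_lt_of_le htI.1 with h | h
    · have := h0 x hxS
      rw [h] at this
      linarith
    · exact h
  obtain ⟨hxint, hdiff, hcd, hineq⟩ := hw x hxS t ⟨htT, htI.2⟩ hwneg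
  have hlap : 0 ≤ laplacian (fun y => w y t) x := by
    apply fj_lap_nonneg hcd
    filter_upwards [mem_interior_iff_mem_nhds.mp hxint] with y hy
    exact le_of_mul_le_mul_left (hmin' y hy t htI) (Real.exp_pos _)
  -- time derivative
  have hderiv : HasDerivAt (fun s => v (x, s))
      (Real.exp (-L * t) * (deriv (w x) t - L * w x t)) t := by
    have h1 : HasDerivAt (fun s : ℝ => Real.exp (-L * s)) (Real.exp (-L * t) * (-L)) t := by
      simpa using ((hasDerivAt_id t).const_mul (-L)).exp
    exact (h1.fun_mul hdiff.hasDerivAt).congr_deriv (by ring)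
  have hdle : Real.exp (-L * t) * (deriv (w x) t - L * w x t) ≤ 0 := by
    have h1 := hderiv.hasDerivWithinAt (s := Iio t)
    rw [hasDerivWithinAt_iff_tendsto_slope' (by simp)] at h1
    apply le_of_tendsto h1
    have : Ioo T0 t ∈ 𝓝[<] t := Ioo_mem_nhdsLT htT
    filter_upwards [this] with s hs
    rw [slope_def_field]
    apply div_nonpos_of_nonneg_of_nonpos
    · linarith [hmin' x hxS s ⟨hs.1.le, hs.2.le.trans htI.2⟩]
    · linarith [hs.2]
  have h1 : deriv (w x) t - L * w x t ≤ 0 := by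
    by_contra h
    push Not at h
    have := mul_pos (Real.exp_pos (-L * t)) h
    linarith
  rw [hL] at h1
  nlinarith

theorem fj_exp_neg (y : ℝ) : y * Real.exp (-y) ≤ 1 := by
  have h1 := Real.add_one_le_exp y
  have h2 := Real.exp_pos (-y)
  have h3 : Real.exp y * Real.exp (-y) = 1 := by rw [← Real.exp_add]; simp
  nlinarith

/-- If `b > 0` then a Gaussian with large radius is small. -/
theorem fj_gauss_small {M ε b r : ℝ} (hε : 0 < ε) (hb : 0 < b) (hr : 1 ≤ r)
    (h : M / (ε * b) ≤ r) (β : ℝ) (hβ : b ≤ β) : M * Real.exp (-(β * r ^ 2)) ≤ ε := by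
  rw [div_le_iff₀ (by positivity)] at h
  have h1 : r ≤ r ^ 2 := by nlinarith
  have h2 : M ≤ ε * (β * r ^ 2) := by
    have : b * r ≤ β * r ^ 2 := by
      have : b * r ≤ β * r := by nlinarith
      nlinarith
    nlinarith
  have h3 := fj_exp_neg (β * r ^ 2)
  have h4 := Real.exp_pos (-(β * r ^ 2))
  nlinarith

section
variable {n : ℕ} {p : ℝ} {u : EuclideanSpace ℝ (Fin n) → ℝ → ℝ}

theorem fj_nonneg
    (hu_cont : ContinuousOn (fun q : EuclideanSpace ℝ (Fin n) × ℝ => u q.1 q.2)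
      {q : EuclideanSpace ℝ (Fin n) × ℝ | 0 ≤ q.2})
    (hu_space : ∀ t : ℝ, 0 < t → ContDiff ℝ 2 (fun x => u x t))
    (hd : ∀ x, ∀ t : ℝ, 0 < t → DifferentiableAt ℝ (u x) t)
    (hbelow : ∃ A : ℝ, ∀ x, ∀ t : ℝ, 0 ≤ t → A ≤ u x t)
    (h0 : ∀ x, 0 ≤ u x 0)
    (hpde : ∀ x, ∀ t : ℝ, 0 < t →
      deriv (u x) t = laplacian (fun y => u y t) x + |u x t| ^ p) :
    ∀ x, ∀ t : ℝ, 0 ≤ t → 0 ≤ u x t := by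
  obtain ⟨A, hA⟩ := hbelow
  intro x t ht
  have key : ∀ ε > 0, 0 ≤ u x t + ε * (‖x - 0‖ ^ 2 + 2 * n * t) := by
    intro ε hε
    have := fj_min_principle (n := n) univ isClosed_univ
      (fun x t => u x t - ((-ε) * ‖x - 0‖ ^ 2 + (-(2 * n * ε)) * t)) 0 t 0 ?_ ?_ ?_ ?_ x
      (mem_univ _) t ⟨ht, le_rfl⟩
    · linarith
    · apply ContinuousOn.sub
      · exact hu_cont.mono (by rintro ⟨y, s⟩ ⟨_, hs⟩; exact hs.1)
      · exact Continuous.continuousOn (by fun_prop)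
    · intro y _
      have := h0 y
      have : 0 ≤ ε * ‖y - 0‖ ^ 2 := by positivity
      linarith [h0 y]
    · intro e he
      refine ⟨max 1 (|A| / ε), fun y _ hy s hs => ?_⟩
      have h1 : 1 ≤ ‖y‖ := (le_max_left _ _).trans hy
      have h2 : |A| / ε ≤ ‖y‖ := (le_max_right _ _).trans hy
      rw [div_le_iff₀ hε] at h2
      have h3 := hA y s hs.1
      have h4 := neg_abs_le A
      have h5 : ‖y‖ ≤ ‖y‖ ^ 2 := by nlinarith
      have h6 : 0 ≤ 2 * n * ε * s := by have := hs.1; positivity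
      simp only [sub_zero]
      nlinarith
    · intro y _ s hs hneg
      have hs0 : 0 < s := hs.1
      have hdl : HasDerivAt (fun s => u y s - ((-ε) * ‖y - 0‖ ^ 2 + (-(2 * n * ε)) * s))
          (deriv (u y) s - (-(2 * n * ε))) s := by
        refine (hd y s hs0).hasDerivAt.fun_sub ?_
        simpa using ((hasDerivAt_id s).const_mul (-(2 * n * ε))).const_add ((-ε) * ‖y - 0‖ ^ 2)
      refine ⟨by simp, hdl.differentiableAt, ?_, ?_⟩
      · exact (hu_space s hs0).sub ((fj_cd_sq _ _).add contDiff_const)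
      · rw [hdl.deriv, fj_lap_sub (hu_space s hs0) ((fj_cd_sq _ _).add contDiff_const),
          fj_lap_add_const, fj_lap_sq, hpde y s hs0]
        have : 0 ≤ |u y s| ^ p := by positivity
        linarith
  by_contra hneg
  push Not at hneg
  set B := ‖x - 0‖ ^ 2 + 2 * n * t with hB
  have hB0 : 0 ≤ B := by positivity
  have := key (-u x t / (2 * (B + 1))) (by apply div_pos <;> linarith)
  have h2 : -u x t / (2 * (B + 1)) * B ≤ -u x t / 2 := by
    rw [div_mul_eq_mul_div, div_le_div_iff₀ (by positivity) (by norm_num)]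
    nlinarith
  linarith

theorem fj_gauss_lower (hn : 1 ≤ n)
    (hu_cont : ContinuousOn (fun q : EuclideanSpace ℝ (Fin n) × ℝ => u q.1 q.2)
      {q : EuclideanSpace ℝ (Fin n) × ℝ | 0 ≤ q.2})
    (hu_space : ∀ t : ℝ, 0 < t → ContDiff ℝ 2 (fun x => u x t))
    (hd : ∀ x, ∀ t : ℝ, 0 < t → DifferentiableAt ℝ (u x) t)
    (hpos : ∀ x, ∀ t : ℝ, 0 ≤ t → 0 ≤ u x t)
    (hpde : ∀ x, ∀ t : ℝ, 0 < t →
      deriv (u x) t = laplacian (fun y => u y t) x + |u x t| ^ p)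
    (x0 : EuclideanSpace ℝ (Fin n)) (t1 : ℝ) (ht1 : 0 ≤ t1) (hu : 0 < u x0 t1) :
    ∃ t0 c C : ℝ, 0 ≤ t0 ∧ 0 < c ∧ 0 < C ∧ ∀ x, c * Real.exp (-(C * ‖x - x0‖ ^ 2)) ≤ u x t0 := by
  set c := u x0 t1 / 2 with hc
  have hc0 : 0 < c := by positivity
  have hcont := hu_cont (x0, t1) ht1
  rw [Metric.continuousWithinAt_iff] at hcont
  obtain ⟨δ, hδ, hnear⟩ := hcont c hc0
  have hnear' : ∀ x t, ‖x - x0‖ ≤ δ / 2 → t1 ≤ t → t ≤ t1 + δ / 2 → c ≤ u x t := by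
    intro x t hx ht ht'
    have h1 := hnear (x := (x, t)) (ht1.trans ht) (by
      rw [Prod.dist_eq, max_lt_iff]
      constructor
      · simp only [dist_eq_norm]; linarith
      · simp only [Real.dist_eq]; rw [abs_of_nonneg (by linarith)]; linarith)
    simp only [Real.dist_eq] at h1
    have := (abs_lt.mp h1).1
    linarith
  have hn0 : (1 : ℝ) ≤ n := by exact_mod_cast hn
  set ρ := δ / 2 with hρ
  have hρ0 : 0 < ρ := by positivity
  set η := min ρ (ρ ^ 2 / n) with hη
  have hη0 : 0 < η := lt_min hρ0 (by positivity)
  have hη1 : η ≤ ρ := min_le_left _ _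
  have hη2 : n * η ≤ ρ ^ 2 := by
    have : η ≤ ρ ^ 2 / n := min_le_right _ _
    rw [le_div_iff₀ (by positivity)] at this
    linarith
  refine ⟨t1 + η, c, η⁻¹, by positivity, hc0, by positivity, ?_⟩
  intro x
  by_cases hx : ‖x - x0‖ ≤ ρ
  · have h1 := hnear' x (t1 + η) hx (by linarith) (by linarith)
    have h2 : Real.exp (-(η⁻¹ * ‖x - x0‖ ^ 2)) ≤ 1 := by
      rw [Real.exp_le_one_iff]
      have : 0 ≤ η⁻¹ * ‖x - x0‖ ^ 2 := by positivity
      linarith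
    nlinarith
  push Not at hx
  refine le_of_forall_pos_le_add fun ε hε => ?_
  set τ := min (η / 2) (ε * ρ ^ 2 / c) with hτ
  have hτ0 : 0 < τ := lt_min (by positivity) (by positivity)
  have hτ1 : τ < η := (min_le_left _ _).trans_lt (by linarith)
  have hτ2 : c * τ ≤ ε * ρ ^ 2 := by
    have : τ ≤ ε * ρ ^ 2 / c := min_le_right _ _
    rw [le_div_iff₀ (by positivity)] at this
    linarith
  have := fj_min_principle (n := n) {y | ρ ≤ ‖y - x0‖} (isClosed_le (by fun_prop) (by fun_prop))
      (fun x t => u x t - (c * Real.exp (-((t - t1)⁻¹ * ‖x - x0‖ ^ 2)) + (-ε)))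
      (t1 + τ) (t1 + η) 0 ?_ ?_ ?_ ?_ x
      hx.le (t1 + η) ⟨by linarith, le_rfl⟩
  · simp only [add_sub_cancel_left] at this
    linarith
  · apply ContinuousOn.sub
    · exact hu_cont.mono (by rintro ⟨y, s⟩ ⟨_, hs⟩; exact le_trans (by linarith) hs.1)
    · have : ContinuousOn (fun q : EuclideanSpace ℝ (Fin n) × ℝ => (q.2 - t1)⁻¹)
          ({y | ρ ≤ ‖y - x0‖} ×ˢ Icc (t1 + τ) (t1 + η)) := by
        apply ContinuousOn.inv₀ (by fun_prop)
        rintro ⟨y, s⟩ ⟨_, hs⟩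
        have := hs.1
        simp only at this ⊢
        intro h
        linarith
      fun_prop
  · intro y hy
    have hy' : ρ ≤ ‖y - x0‖ := hy
    simp only [add_sub_cancel_left]
    have h1 := hpos y (t1 + τ) (by linarith)
    have h3 := fj_exp_neg (τ⁻¹ * ‖y - x0‖ ^ 2)
    have h4 := Real.exp_pos (-(τ⁻¹ * ‖y - x0‖ ^ 2))
    have h5 : c ≤ ε * (τ⁻¹ * ‖y - x0‖ ^ 2) := by
      have h6 : ρ ^ 2 ≤ ‖y - x0‖ ^ 2 := by gcongr
      have h7 : c * τ ≤ ε * ‖y - x0‖ ^ 2 := by nlinarith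
      calc c = τ⁻¹ * (c * τ) := by field_simp
        _ ≤ τ⁻¹ * (ε * ‖y - x0‖ ^ 2) := by gcongr
        _ = _ := by ring
    nlinarith
  · intro e he
    refine ⟨‖x0‖ + max 1 (c / (ε * η⁻¹)), fun y _ hy s hs => ?_⟩
    have h1 : max 1 (c / (ε * η⁻¹)) ≤ ‖y - x0‖ := by
      have := norm_sub_norm_le y x0
      linarith
    have h2 := fj_gauss_small (M := c) hε (inv_pos.mpr hη0) ((le_max_left _ _).trans h1)
      ((le_max_right _ _).trans h1) ((s - t1)⁻¹) (by
        apply inv_anti₀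
        · linarith [hs.1]
        · linarith [hs.2])
    have := hpos y s (by linarith [hs.1])
    linarith
  · intro y hy s hs hneg
    have hs0 : 0 < s := by linarith [hs.1]
    have hs1 : 0 < s - t1 := by linarith [hs.1]
    have hy' : ρ ≤ ‖y - x0‖ := hy
    have hy2 : ρ < ‖y - x0‖ := by
      by_contra h
      push Not at h
      have h1 := hnear' y s h (by linarith) (by linarith [hs.2])
      have h2 : Real.exp (-((s - t1)⁻¹ * ‖y - x0‖ ^ 2)) ≤ 1 := by
        rw [Real.exp_le_one_iff]
        have : 0 ≤ (s - t1)⁻¹ * ‖y - x0‖ ^ 2 := by positivity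
        linarith
      nlinarith
    have hdl : HasDerivAt (fun s => u y s -
          (c * Real.exp (-((s - t1)⁻¹ * ‖y - x0‖ ^ 2)) + (-ε)))
        (deriv (u y) s - c * (Real.exp (-((s - t1)⁻¹ * ‖y - x0‖ ^ 2)) *
          (-(-1 / (s - t1) ^ 2 * ‖y - x0‖ ^ 2)))) s := by
      refine (hd y s hs0).hasDerivAt.fun_sub ?_
      have h1 : HasDerivAt (fun s : ℝ => (s - t1)⁻¹) (-1 / (s - t1) ^ 2) s :=
        ((hasDerivAt_id s).sub_const t1).fun_inv hs1.ne'
      exact ((((h1.mul_const _).fun_neg).exp).const_mul c).add_const _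
    refine ⟨?_, hdl.differentiableAt, ?_, ?_⟩
    · rw [mem_interior_iff_mem_nhds]
      have : IsOpen {y : EuclideanSpace ℝ (Fin n) | ρ < ‖y - x0‖} :=
        isOpen_lt (by fun_prop) (by fun_prop)
      filter_upwards [this.mem_nhds hy2] with z hz
      exact le_of_lt hz
    · exact (hu_space s hs0).sub ((fj_cd_gauss _ _ _).add contDiff_const)
    · rw [hdl.deriv, fj_lap_sub (hu_space s hs0) ((fj_cd_gauss _ _ _).add contDiff_const),
          fj_lap_add_const, fj_lap_gauss, hpde y s hs0]
      have hu0 : 0 ≤ |u y s| ^ p := by positivity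
      set r2 := ‖y - x0‖ ^ 2 with hr2
      have h6 : ρ ^ 2 ≤ r2 := by rw [hr2]; gcongr
      set σ := s - t1 with hσ
      have hσ1 : σ ≤ η := by linarith [hs.2]
      set E := Real.exp (-(σ⁻¹ * r2)) with hE
      have hE0 : 0 < E := Real.exp_pos _
      have h7 : 0 ≤ (4 * σ⁻¹ ^ 2 * r2 - 2 * n * σ⁻¹) - r2 / σ ^ 2 := by
        have : (4 * σ⁻¹ ^ 2 * r2 - 2 * n * σ⁻¹) - r2 / σ ^ 2 = (3 * r2 - 2 * n * σ) / σ ^ 2 := by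
          field_simp
          ring
        rw [this]
        apply div_nonneg _ (by positivity)
        have : n * σ ≤ n * η := by gcongr
        have : 0 < ρ ^ 2 := by positivity
        linarith
      have h8 := mul_nonneg (mul_pos hc0 hE0).le h7
      have h9 : c * (E * (-(-1 / σ ^ 2 * r2))) = c * E * (r2 / σ ^ 2) := by ring
      rw [h9]
      linarith

theorem fj_compare (hp : 1 < p)
    (hu_cont : ContinuousOn (fun q : EuclideanSpace ℝ (Fin n) × ℝ => u q.1 q.2)
      {q : EuclideanSpace ℝ (Fin n) × ℝ | 0 ≤ q.2})
    (hu_space : ∀ t : ℝ, 0 < t → ContDiff ℝ 2 (fun x => u x t))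
    (hd : ∀ x, ∀ t : ℝ, 0 < t → DifferentiableAt ℝ (u x) t)
    (hpos : ∀ x, ∀ t : ℝ, 0 ≤ t → 0 ≤ u x t)
    (hpde : ∀ x, ∀ t : ℝ, 0 < t →
      deriv (u x) t = laplacian (fun y => u y t) x + |u x t| ^ p)
    (x0 : EuclideanSpace ℝ (Fin n)) (t0 T1 : ℝ) (ht0 : 0 ≤ t0) (hT : t0 ≤ T1)
    (a β a' β' : ℝ → ℝ) (b : ℝ) (hb : 0 < b)
    (ha : ∀ t ∈ Icc t0 T1, HasDerivAt a (a' t) t)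
    (hβ : ∀ t ∈ Icc t0 T1, HasDerivAt β (β' t) t)
    (hapos : ∀ t ∈ Icc t0 T1, 0 < a t) (hbβ : ∀ t ∈ Icc t0 T1, b ≤ β t)
    (hinit : ∀ x, a t0 * Real.exp (-(β t0 * ‖x - x0‖ ^ 2)) ≤ u x t0)
    (hsub : ∀ t ∈ Icc t0 T1, ∀ r : ℝ, 0 ≤ r → a' t - a t * (β' t * r) ≤
      a t * (4 * β t ^ 2 * r - 2 * n * β t) + a t * (a t ^ (p - 1) * Real.exp (-((p - 1) * β t * r)))) :
    ∀ x, ∀ t ∈ Icc t0 T1, a t * Real.exp (-(β t * ‖x - x0‖ ^ 2)) ≤ u x t := by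
  intro x t ht
  have hac : ContinuousOn a (Icc t0 T1) := fun t ht => (ha t ht).continuousAt.continuousWithinAt
  have hβc : ContinuousOn β (Icc t0 T1) := fun t ht => (hβ t ht).continuousAt.continuousWithinAt
  obtain ⟨M, hM⟩ := isCompact_Icc.bddAbove_image hac
  have hM' : ∀ t ∈ Icc t0 T1, a t ≤ M := fun t ht => hM (mem_image_of_mem _ ht)
  have := fj_min_principle (n := n) univ isClosed_univ
      (fun x t => u x t - a t * Real.exp (-(β t * ‖x - x0‖ ^ 2)))
      t0 T1 (p * M ^ (p - 1)) ?_ ?_ ?_ ?_ x (mem_univ _) t ht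
  · linarith
  · apply ContinuousOn.sub
    · exact hu_cont.mono (by rintro ⟨y, s⟩ ⟨_, hs⟩; exact le_trans ht0 hs.1)
    · have hm : MapsTo (fun q : EuclideanSpace ℝ (Fin n) × ℝ => q.2) (univ ×ˢ Icc t0 T1)
          (Icc t0 T1) := fun q hq => hq.2
      have h1 := hac.comp (continuous_snd.continuousOn) hm
      have h2 := hβc.comp (continuous_snd.continuousOn) hm
      simp only [Function.comp_def] at h1 h2
      fun_prop
  · intro y _
    linarith [hinit y]
  · intro e he
    refine ⟨‖x0‖ + max 1 (M / (e * b)), fun y _ hy s hs => ?_⟩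
    have h1 : max 1 (M / (e * b)) ≤ ‖y - x0‖ := by
      have := norm_sub_norm_le y x0
      linarith
    have h2 := fj_gauss_small (M := M) he hb ((le_max_left _ _).trans h1)
      ((le_max_right _ _).trans h1) (β s) (hbβ s hs)
    have h3 := hpos y s (by linarith [hs.1])
    have h4 : a s * Real.exp (-(β s * ‖y - x0‖ ^ 2)) ≤ M * Real.exp (-(β s * ‖y - x0‖ ^ 2)) :=
      mul_le_mul_of_nonneg_right (hM' s hs) (Real.exp_pos _).le
    linarith
  · intro y _ s hs hneg
    have hs0 : 0 < s := by linarith [hs.1]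
    have hs' : s ∈ Icc t0 T1 := ⟨hs.1.le, hs.2⟩
    have hdl : HasDerivAt (fun s => u y s - a s * Real.exp (-(β s * ‖y - x0‖ ^ 2)))
        (deriv (u y) s - (a' s * Real.exp (-(β s * ‖y - x0‖ ^ 2)) +
          a s * (Real.exp (-(β s * ‖y - x0‖ ^ 2)) * (-(β' s * ‖y - x0‖ ^ 2))))) s :=
      (hd y s hs0).hasDerivAt.fun_sub
        ((ha s hs').fun_mul ((((hβ s hs').mul_const _).fun_neg).exp))
    refine ⟨by simp, hdl.differentiableAt, (hu_space s hs0).sub (fj_cd_gauss _ _ _), ?_⟩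
    rw [hdl.deriv, fj_lap_sub (hu_space s hs0) (fj_cd_gauss _ _ _), fj_lap_gauss, hpde y s hs0]
    have hu0 := hpos y s hs0.le
    rw [abs_of_nonneg hu0]
    have hsb := hsub s hs' (‖y - x0‖ ^ 2) (by positivity)
    have ha0 := hapos s hs'
    set r2 := ‖y - x0‖ ^ 2 with hr2
    set E := Real.exp (-(β s * r2)) with hE
    have hE0 : 0 < E := Real.exp_pos _
    have hE1 : E ≤ 1 := by
      rw [hE, Real.exp_le_one_iff]
      have : 0 ≤ β s * r2 := mul_nonneg (hb.le.trans (hbβ s hs')) (by positivity)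
      linarith
    set z := a s * E with hz
    have hz0 : 0 < z := mul_pos ha0 hE0
    have hzM : z ≤ M := by
      have := hM' s hs'
      nlinarith
    -- z^(p-1)
    have hzq : z ^ (p - 1) = a s ^ (p - 1) * Real.exp (-((p - 1) * β s * r2)) := by
      rw [hz, Real.mul_rpow ha0.le hE0.le, hE, ← Real.exp_mul]
      ring_nf
    rw [← hzq] at hsb
    have hsb2 : (a' s - a s * (β' s * r2)) * E ≤ (a s * (4 * β s ^ 2 * r2 - 2 * n * β s)
      + a s * z ^ (p - 1)) * E := mul_le_mul_of_nonneg_right hsb hE0.le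
    -- Bernoulli
    have hzp : z ^ p = z * z ^ (p - 1) := by
      rw [← Real.rpow_one_add' hz0.le (by linarith)]
      ring_nf
    have hbern : p * z ^ (p - 1) * (u y s - z) ≤ u y s ^ p - z ^ p := by
      have h1 := one_add_mul_self_le_rpow_one_add (s := u y s / z - 1) (p := p)
        (by have : 0 ≤ u y s / z := by positivity
            linarith) hp.le
      have h2 : 1 + (u y s / z - 1) = u y s / z := by ring
      rw [h2, Real.div_rpow hu0 hz0.le, le_div_iff₀ (by positivity)] at h1
      have h3 : (1 + p * (u y s / z - 1)) * z ^ p = z ^ p + p * z ^ (p - 1) * (u y s - z) := by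
        rw [hzp]
        field_simp
      linarith
    have hq : z ^ (p - 1) ≤ M ^ (p - 1) := Real.rpow_le_rpow hz0.le hzM (by linarith)
    have hK : p * M ^ (p - 1) * (u y s - z) ≤ p * z ^ (p - 1) * (u y s - z) := by
      apply mul_le_mul_of_nonpos_right _ hneg.le
      gcongr
    have e1 : a s * z ^ (p - 1) * E = z ^ p := by rw [hzp, hz]; ring
    have e2 : a s * (4 * β s ^ 2 * r2 - 2 * n * β s) * E
      = z * (4 * β s ^ 2 * r2 - 2 * n * β s) := by rw [hz]; ring
    linarith

theorem fj_alg {q k ℓ s N r : ℝ} (hq : 0 < q) (hk : k = Real.exp (-1)) (hl : 0 < ℓ) (hs : 0 < s)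
    (hN : N * q ≤ 2) (hr : 0 ≤ r) :
    -(ℓ - k * q) / (q * ℓ * s)
      - ((k * q * (k * q / s) / ℓ ^ 2) / (4 * s) - (1 + k * q / ℓ) / (4 * s ^ 2)) * r ≤
    (4 * ((1 + k * q / ℓ) / (4 * s)) ^ 2 * r - 2 * N * ((1 + k * q / ℓ) / (4 * s)))
      + (ℓ * s)⁻¹ * Real.exp (-(q * ((1 + k * q / ℓ) / (4 * s)) * r)) := by
  have hk0 : 0 < k := by rw [hk]; exact Real.exp_pos _
  set d := k * q / ℓ with hd
  have hd0 : 0 < d := by positivity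
  set B := (1 + d) / (4 * s) with hB
  have hB0 : 0 < B := by positivity
  set Y := q * B * r with hY
  have hexp : k * (2 - Y) ≤ Real.exp (-Y) := by
    have h1 := Real.add_one_le_exp (1 - Y)
    have h2 : Real.exp (-Y) = k * Real.exp (1 - Y) := by
      rw [hk, ← Real.exp_add]; ring_nf
    rw [h2]
    gcongr
    linarith
  have h1 : (ℓ * s)⁻¹ * (k * (2 - Y)) ≤ (ℓ * s)⁻¹ * Real.exp (-Y) := by gcongr
  have h2 : -(ℓ - k * q) / (q * ℓ * s) = -(1 / (q * s)) + k * (ℓ * s)⁻¹ := by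
    field_simp
    ring
  have h3 : 2 * N * B ≤ 1 / (q * s) + k * (ℓ * s)⁻¹ := by
    have e : 1 / (q * s) + k * (ℓ * s)⁻¹ = (2 / q) * ((1 + d) / (2 * s)) := by
      rw [hd]; field_simp
    have e2 : 2 * N * B = N * ((1 + d) / (2 * s)) := by rw [hB]; field_simp; ring
    rw [e, e2]
    apply mul_le_mul_of_nonneg_right _ (by positivity)
    rw [le_div_iff₀ hq]; exact hN
  have h4 : (ℓ * s)⁻¹ * k * Y ≤ 4 * B ^ 2 * r +
      ((k * q * (k * q / s) / ℓ ^ 2) / (4 * s) - (1 + d) / (4 * s ^ 2)) * r := by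
    have e : 4 * B ^ 2 * r +
      ((k * q * (k * q / s) / ℓ ^ 2) / (4 * s) - (1 + d) / (4 * s ^ 2)) * r
       = (ℓ * s)⁻¹ * k * Y + (k * q * (k * q / s) / ℓ ^ 2) / (4 * s) * r := by
      rw [hY, hB, hd]
      field_simp
      ring
    rw [e]
    have : 0 ≤ (k * q * (k * q / s) / ℓ ^ 2) / (4 * s) * r := by positivity
    linarith
  rw [h2]
  nlinarith

theorem fj_blowup (hp : 1 < p) (hnp : n * (p - 1) ≤ 2)
    (hu_cont : ContinuousOn (fun q : EuclideanSpace ℝ (Fin n) × ℝ => u q.1 q.2)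
      {q : EuclideanSpace ℝ (Fin n) × ℝ | 0 ≤ q.2})
    (hu_space : ∀ t : ℝ, 0 < t → ContDiff ℝ 2 (fun x => u x t))
    (hd : ∀ x, ∀ t : ℝ, 0 < t → DifferentiableAt ℝ (u x) t)
    (hpos : ∀ x, ∀ t : ℝ, 0 ≤ t → 0 ≤ u x t)
    (hpde : ∀ x, ∀ t : ℝ, 0 < t →
      deriv (u x) t = laplacian (fun y => u y t) x + |u x t| ^ p)
    (x0 : EuclideanSpace ℝ (Fin n)) (t0 c C : ℝ) (ht0 : 0 ≤ t0) (hc : 0 < c) (hC : 0 < C)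
    (hlow : ∀ x, c * Real.exp (-(C * ‖x - x0‖ ^ 2)) ≤ u x t0) : False := by
  set q := p - 1 with hq
  have hq0 : 0 < q := by rw [hq]; linarith
  set k := Real.exp (-1) with hk
  have hk0 : 0 < k := Real.exp_pos _
  set s0 := 1 / (4 * C) with hs0
  have hs00 : 0 < s0 := by positivity
  set ℓ0 := (s0 * c ^ q)⁻¹ with hl0
  have hl00 : 0 < ℓ0 := by positivity
  set s : ℝ → ℝ := fun t => s0 + (t - t0) with hs
  set ℓ : ℝ → ℝ := fun t => ℓ0 - k * q * (Real.log (s t) - Real.log s0) with hl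
  set Ts := t0 + s0 * (Real.exp (ℓ0 / (k * q)) - 1) with hTs
  have hexp1 : 1 < Real.exp (ℓ0 / (k * q)) := Real.one_lt_exp_iff.mpr (by positivity)
  have hTs0 : t0 < Ts := by
    have := mul_pos hs00 (sub_pos.mpr hexp1)
    linarith
  have hsTs : s Ts = s0 * Real.exp (ℓ0 / (k * q)) := by simp only [hs, hTs]; ring
  have hspos : ∀ t, t0 ≤ t → 0 < s t := fun t ht => by simp only [hs]; linarith
  have hlTs : ℓ Ts = 0 := by
    simp only [hl]
    rw [hsTs, Real.log_mul hs00.ne' (Real.exp_pos _).ne', Real.log_exp]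
    field_simp
    ring
  have hlpos : ∀ t, t0 ≤ t → t < Ts → 0 < ℓ t := by
    intro t ht htT
    rw [← hlTs]
    simp only [hl]
    have h1 : Real.log (s t) < Real.log (s Ts) := by
      apply Real.log_lt_log (hspos t ht)
      simp only [hs]; linarith
    have : 0 < k * q := by positivity
    nlinarith
  have hsd : ∀ t, HasDerivAt s 1 t := fun t => by
    exact ((hasDerivAt_id t).sub_const t0).const_add s0
  have hld : ∀ t, t0 ≤ t → HasDerivAt ℓ (-(k * q / s t)) t := by
    intro t ht
    have h1 := (hsd t).log (hspos t ht).ne'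
    exact (((h1.sub_const (Real.log s0)).const_mul (k * q)).const_sub ℓ0).congr_deriv (by ring)
  set a : ℝ → ℝ := fun t => (ℓ t * s t) ^ (-(1 / q)) with ha
  set β : ℝ → ℝ := fun t => (1 + k * q / ℓ t) / (4 * s t) with hβ
  have hinit_s : s t0 = s0 := by simp [hs]
  have hinit_l : ℓ t0 = ℓ0 := by simp [hl, hinit_s]
  have haq : ∀ t, t0 ≤ t → t < Ts → a t ^ q = (ℓ t * s t)⁻¹ := by
    intro t ht htT
    have h1 := mul_pos (hlpos t ht htT) (hspos t ht)
    simp only [ha]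
    rw [← Real.rpow_mul h1.le, show -(1 / q) * q = -1 by field_simp, Real.rpow_neg_one]
  have hcomp : ∀ T1, t0 ≤ T1 → T1 < Ts → a T1 ≤ u x0 T1 := by
    intro T1 hT1 hT1s
    have := fj_compare (n := n) (p := p) (u := u) hp hu_cont hu_space hd hpos hpde x0 t0 T1 ht0 hT1
      a β (fun t => a t * (-(ℓ t - k * q) / (q * ℓ t * s t)))
      (fun t => (k * q * (k * q / s t) / ℓ t ^ 2) / (4 * s t) - (1 + k * q / ℓ t) / (4 * s t ^ 2))
      (1 / (4 * s T1)) (by have := hspos T1 hT1; positivity) ?_ ?_ ?_ ?_ ?_ ?_ x0 T1 ⟨hT1, le_rfl⟩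
    · simpa using this
    · intro t ht
      have h1 := hlpos t ht.1 (ht.2.trans_lt hT1s)
      have h2 := hspos t ht.1
      have h3 := (((hld t ht.1).fun_mul (hsd t)).rpow_const (p := -(1 / q))
        (Or.inl (mul_pos h1 h2).ne'))
      refine h3.congr_deriv ?_
      simp only [ha]
      rw [Real.rpow_sub_one (mul_pos h1 h2).ne']
      field_simp
      ring
    · intro t ht
      have h1 := hlpos t ht.1 (ht.2.trans_lt hT1s)
      have h2 := hspos t ht.1
      have h3 := (((hasDerivAt_const t (k * q)).fun_div (hld t ht.1) h1.ne').const_add 1).fun_div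
        ((hsd t).const_mul 4) (by positivity)
      refine h3.congr_deriv ?_
      field_simp
      ring
    · intro t ht
      have h1 := hlpos t ht.1 (ht.2.trans_lt hT1s)
      have h2 := hspos t ht.1
      simp only [ha]
      positivity
    · intro t ht
      have h1 := hlpos t ht.1 (ht.2.trans_lt hT1s)
      have h2 := hspos t ht.1
      simp only [hβ]
      have h3 : s t ≤ s T1 := by simp only [hs]; linarith [ht.2]
      have h4 : 0 ≤ k * q / ℓ t := by positivity
      apply div_le_div₀ <;> linarith
    · intro x
      refine le_trans ?_ (hlow x)
      have h1 : a t0 = c := by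
        simp only [ha]
        rw [hinit_l, hinit_s, hl0]
        have : (s0 * c ^ q)⁻¹ * s0 = c ^ (-q) := by
          rw [Real.rpow_neg hc.le]; field_simp
        rw [this, ← Real.rpow_mul hc.le, show -q * -(1 / q) = 1 by field_simp, Real.rpow_one]
      have h2 : C ≤ β t0 := by
        simp only [hβ]
        rw [hinit_l, hinit_s]
        have h3 : C = 1 / (4 * s0) := by rw [hs0]; field_simp
        have h4 : 0 ≤ k * q / ℓ0 := by positivity
        rw [h3]
        gcongr
        linarith
      rw [h1]
      gcongr
    · intro t ht r hr
      have h1 := hlpos t ht.1 (ht.2.trans_lt hT1s)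
      have h2 := hspos t ht.1
      have h3 := fj_alg (N := n) hq0 hk h1 h2 hnp hr
      have h4 : 0 < a t := by simp only [ha]; positivity
      rw [← hq, haq t ht.1 (ht.2.trans_lt hT1s)]
      have h5 := mul_le_mul_of_nonneg_left h3 h4.le
      simp only [hβ]
      linarith
  -- bound for u x0 on [t0, Ts]
  have hcu : ContinuousOn (fun t => u x0 t) (Icc t0 Ts) := by
    have hm : MapsTo (fun t : ℝ => (x0, t)) (Icc t0 Ts)
      {q : EuclideanSpace ℝ (Fin n) × ℝ | 0 ≤ q.2} := fun t ht => ht0.trans ht.1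
    exact hu_cont.comp (by fun_prop) hm
  obtain ⟨M, hM⟩ := isCompact_Icc.bddAbove_image hcu
  have hM' : ∀ t ∈ Icc t0 Ts, u x0 t ≤ M := fun t ht => hM (mem_image_of_mem _ ht)
  have hge : ∀ t ∈ Ioo t0 Ts, 1 ≤ ℓ t * s t * M ^ q := by
    intro t ht
    have h1 := mul_pos (hlpos t ht.1.le ht.2) (hspos t ht.1.le)
    have h4 : 0 < a t := by simp only [ha]; positivity
    have h5 : a t ^ q ≤ M ^ q := Real.rpow_le_rpow h4.le
      ((hcomp t ht.1.le ht.2).trans (hM' t ⟨ht.1.le, ht.2.le⟩)) hq0.le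
    rw [haq t ht.1.le ht.2] at h5
    calc 1 = ℓ t * s t * (ℓ t * s t)⁻¹ := (mul_inv_cancel₀ h1.ne').symm
      _ ≤ _ := by gcongr
  have hlim : Tendsto (fun t => ℓ t * s t * M ^ q) (𝓝[<] Ts) (𝓝 (ℓ Ts * s Ts * M ^ q)) := by
    have := (((hld Ts hTs0.le).continuousAt.mul (hsd Ts).continuousAt).mul_const (M ^ q))
    exact this.tendsto.mono_left nhdsWithin_le_nhds
  have hfin : 1 ≤ ℓ Ts * s Ts * M ^ q := by
    apply ge_of_tendsto hlim
    filter_upwards [Ioo_mem_nhdsLT hTs0] with t ht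
    exact hge t ht
  rw [hlTs] at hfin
  norm_num at hfin

end

/-- Fujita-type nonexistence up to the critical exponent: for `1 < p ≤ 1 + 2/n`, any
bounded-below classical solution of `u_t = Δu + |u|^p` on `ℝⁿ × (0,∞)` with nonnegative
initial datum is identically zero. -/
theorem fujita_triviality
    {n : ℕ} (hn : 1 ≤ n) (p : ℝ) (hp : 1 < p) (hpn : p ≤ 1 + 2 / (n : ℝ))
    (u : EuclideanSpace ℝ (Fin n) → ℝ → ℝ)
    -- u is continuous up to t = 0
    (hu_cont : ContinuousOn (fun q : EuclideanSpace ℝ (Fin n) × ℝ => u q.1 q.2)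
      {q : EuclideanSpace ℝ (Fin n) × ℝ | 0 ≤ q.2})
    -- u is C² in the space variable for every t > 0
    (hu_space : ∀ t : ℝ, 0 < t → ContDiff ℝ 2 (fun x => u x t))
    -- u is C¹ in the time variable on (0,∞)
    (hu_time : ∀ x, ContDiffOn ℝ 1 (fun s => u x s) (Ioi 0))
    -- u is bounded from below
    (hbelow : ∃ A : ℝ, ∀ x, ∀ t : ℝ, 0 ≤ t → A ≤ u x t)
    -- nonnegative initial datum
    (h0 : ∀ x, 0 ≤ u x 0)
    -- u solves u_t = Δu + |u|^p on ℝⁿ × (0,∞)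
    (hpde : ∀ x, ∀ t : ℝ, 0 < t →
      deriv (fun s => u x s) t = laplacian (fun y => u y t) x + |u x t| ^ p) :
    ∀ x, ∀ t : ℝ, 0 ≤ t → u x t = 0 := by
  have hd : ∀ x, ∀ t : ℝ, 0 < t → DifferentiableAt ℝ (u x) t := by
    intro x t ht
    exact ((hu_time x).differentiableOn (by norm_num)).differentiableAt (Ioi_mem_nhds ht)
  have hpos := fj_nonneg hu_cont hu_space hd hbelow h0 hpde
  intro x t ht
  by_contra hne
  have hux : 0 < u x t := lt_of_le_of_ne (hpos x t ht) (Ne.symm hne)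
  obtain ⟨t0, c, C, ht0, hc, hC, hlow⟩ :=
    fj_gauss_lower hn hu_cont hu_space hd hpos hpde x t ht hux
  have hn0 : (0 : ℝ) < n := by exact_mod_cast hn
  have hnp : n * (p - 1) ≤ 2 := by
    have h1 : p - 1 ≤ 2 / n := by linarith
    rw [le_div_iff₀ hn0] at h1
    linarith
  exact fj_blowup hp hnp hu_cont hu_space hd hpos hpde x t0 c C ht0 hc hC hlow
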